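/- arXiv:math/0403326 — 4 statements merged into one kernel-verified Lean document; each statement's English description precedes it below -/
import Mathlib

section
/- Let n ≥ 1 and let a : Fin n → ℕ be an admissible width sequence. Then twice the width equals the sum of the squares of the values at thick indices minus the sum of the squares of the values at thin indices: 2·(Σᵢ a i) = Σ_{i thick} (a i)² − Σ_{i thin} (a i)². -/
/-- The padding of a sequence `a : Fin n → ℕ`: index `j` with `1 ≤ j ≤ n`
corresponds to `a (j-1)`, and the values just outside (`j = 0` and `j = n+1`,
i.e. positions `-1` and `n` of `a`) are `0`. -/
def padded (n : ℕ) (a : Fin n → ℕ) (j : ℕ) : ℕ :=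
  if h : 1 ≤ j ∧ j ≤ n then a ⟨j - 1, by omega⟩ else 0

/-- `a : Fin n → ℕ` is an admissible width sequence: `n ≥ 1`, the first and last
values are `2`, every value is at least `2`, and consecutive values differ by
exactly `2`.  (Stated via the padded sequence: positions `1, …, n`.) -/
structure IsWidthSeq (n : ℕ) (a : Fin n → ℕ) : Prop where
  pos : 1 ≤ n
  first : padded n a 1 = 2
  last : padded n a n = 2
  two_le : ∀ i : Fin n, 2 ≤ a i
  step : ∀ j : ℕ, 1 ≤ j → j < n →
    padded n a (j + 1) = padded n a j + 2 ∨ padded n a j = padded n a (j + 1) + 2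

/-- An index `i` of `a` is thick if, in the padded sequence, the value at `i` is
greater than both neighbors (position `i` of `a` is position `i+1` of the padding). -/
def IsThick (n : ℕ) (a : Fin n → ℕ) (i : Fin n) : Prop :=
  padded n a i.val < padded n a (i.val + 1) ∧ padded n a (i.val + 2) < padded n a (i.val + 1)

/-- An index `i` of `a` is thin if, in the padded sequence, the value at `i` is
smaller than both neighbors. -/
def IsThin (n : ℕ) (a : Fin n → ℕ) (i : Fin n) : Prop :=
  padded n a (i.val + 1) < padded n a i.val ∧ padded n a (i.val + 1) < padded n a (i.val + 2)

instance (n : ℕ) (a : Fin n → ℕ) : DecidablePred (IsThick n a) := fun i => by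
  unfold IsThick; infer_instance

instance (n : ℕ) (a : Fin n → ℕ) : DecidablePred (IsThin n a) := fun i => by
  unfold IsThin; infer_instance

/-- For an admissible width sequence, twice the width equals the
sum of squares of the values at thick indices minus the sum of squares of the
values at thin indices. -/
theorem two_mul_width_eq_thick_sq_sub_thin_sq
    (n : ℕ) (hn : 1 ≤ n) (a : Fin n → ℕ) (ha : IsWidthSeq n a) :
    (2 * ∑ i : Fin n, (a i : ℤ)) =
      (∑ i ∈ Finset.univ.filter (IsThick n a), (a i : ℤ) ^ 2) -
        (∑ i ∈ Finset.univ.filter (IsThin n a), (a i : ℤ) ^ 2) := by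
  have hstep : ∀ j, j ≤ n →
      padded n a (j + 1) = padded n a j + 2 ∨ padded n a j = padded n a (j + 1) + 2 := by
    intro j hj
    rcases Nat.eq_zero_or_pos j with h0 | h0
    · subst h0
      left
      have h : padded n a 0 = 0 := by simp [padded]
      rw [h]
      exact ha.first
    · rcases Nat.lt_or_ge j n with h | h
      · exact ha.step j h0 h
      · have hjn : j = n := by omega
        subst hjn
        right
        have h : padded j a (j + 1) = 0 := by simp [padded]
        rw [h]
        exact ha.last
  let G : ℕ → ℤ := fun j =>
    (if padded n a j < padded n a (j + 1) then 1 else -1) *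
      ((padded n a j : ℤ) * (padded n a (j + 1) : ℤ))
  have hG0 : G 0 = 0 := by simp [G, padded]
  have hGn : G n = 0 := by
    have h : padded n a (n + 1) = 0 := by simp [padded]
    simp [G, h]
  have htel : ∑ i : Fin n, (G (i.val + 1) - G i.val) = 0 := by
    rw [Fin.sum_univ_eq_sum_range (fun j => G (j + 1) - G j) n, Finset.sum_range_sub, hG0, hGn]
    simp
  have key : ∀ i : Fin n, 4 * (a i : ℤ) =
      2 * (if IsThick n a i then (a i : ℤ) ^ 2 else 0) -
        2 * (if IsThin n a i then (a i : ℤ) ^ 2 else 0) + (G (i.val + 1) - G i.val) := by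
    intro i
    have hi := i.isLt
    have hai : a i = padded n a (i.val + 1) := by
      simp [padded]
    have h1 := hstep i.val (by omega)
    have h2 := hstep (i.val + 1) (by omega)
    simp only [G, IsThick, IsThin, hai]
    rw [show i.val + 1 + 1 = i.val + 2 from rfl] at *
    generalize padded n a i.val = x at *
    generalize padded n a (i.val + 1) = y at *
    generalize padded n a (i.val + 2) = z at *
    rcases h1 with h1 | h1 <;> rcases h2 with h2 | h2 <;> subst h1 <;>
      first | subst h2 | (obtain rfl := Nat.add_right_cancel h2)
    all_goals
      simp <;> (try push_cast) <;> (try split_ifs) <;> first | omega | ring | (ring_nf; omega)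
  have hsum := Finset.sum_congr (rfl : (Finset.univ : Finset (Fin n)) = Finset.univ)
    (fun i _ => key i)
  rw [Finset.sum_add_distrib, htel, Finset.sum_sub_distrib, ← Finset.mul_sum, ← Finset.mul_sum,
    ← Finset.mul_sum] at hsum
  rw [Finset.sum_filter, Finset.sum_filter]
  linarith
end

section
/- Let n ≥ 1 and let a : Fin n → ℕ be an admissible width sequence. Suppose for some index i with i + 2 ≤ n − 1 we have a(i+1) = a(i) + 2, a(i+2) = a(i), and a(i) ≥ 4 (so levels i, i+1, i+2 record a minimum immediately followed by a maximum of the knot). Then the sequence a' that agrees with a except that a'(i+1) = a(i) − 2 (recording the minimum pushed up above the maximum) is again an admissible width sequence, and its width satisfies Σᵢ a' i = (Σᵢ a i) − 4; in particular the width strictly decreases. -/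
/-- If an admissible width sequence records a minimum immediately
followed by a maximum (`a (i+1) = a i + 2`, `a (i+2) = a i`, with `a i ≥ 4`), then
replacing the value at `i+1` by `a i − 2` (pushing the minimum above the maximum)
yields an admissible width sequence whose width is smaller by exactly `4`;
in particular the width strictly decreases. -/
theorem width_decreases_after_exchange
    (n : ℕ) (hn : 1 ≤ n) (a : Fin n → ℕ) (ha : IsWidthSeq n a)
    (i : ℕ) (hi : i + 2 ≤ n - 1)
    (h1 : a ⟨i + 1, by omega⟩ = a ⟨i, by omega⟩ + 2)
    (h2 : a ⟨i + 2, by omega⟩ = a ⟨i, by omega⟩)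
    (h4 : 4 ≤ a ⟨i, by omega⟩)
    (a' : Fin n → ℕ)
    (ha' : ∀ j : Fin n,
      a' j = if j.val = i + 1 then a ⟨i, by omega⟩ - 2 else a j) :
    IsWidthSeq n a' ∧ (∑ j : Fin n, a' j) + 4 = ∑ j : Fin n, a j ∧
      (∑ j : Fin n, a' j) < ∑ j : Fin n, a j := by
  have hp : ∀ j, padded n a' j = if j = i + 2 then a ⟨i, by omega⟩ - 2 else padded n a j := by
    intro j
    unfold padded
    by_cases hj : 1 ≤ j ∧ j ≤ n
    · rw [dif_pos hj, dif_pos hj, ha']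
      by_cases hji : j = i + 2
      · simp [hji]
      · have : ¬ (j - 1 = i + 1) := by omega
        simp [hji, this]
    · have : j ≠ i + 2 := by omega
      simp [hj, this]
  have p1 : padded n a (i + 1) = a ⟨i, by omega⟩ := by
    unfold padded
    rw [dif_pos (by omega)]
    simp
  have p3 : padded n a (i + 3) = a ⟨i, by omega⟩ := by
    unfold padded
    rw [dif_pos (by omega), ← h2]
    simp
  have hs : (∑ j : Fin n, a' j) + 4 = ∑ j : Fin n, a j := by
    have hm : (⟨i + 1, by omega⟩ : Fin n) ∈ Finset.univ := Finset.mem_univ _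
    rw [← Finset.add_sum_erase _ a' hm, ← Finset.add_sum_erase _ a hm]
    have he : ∑ j ∈ Finset.univ.erase (⟨i + 1, by omega⟩ : Fin n), a' j
        = ∑ j ∈ Finset.univ.erase (⟨i + 1, by omega⟩ : Fin n), a j := by
      apply Finset.sum_congr rfl
      intro j hj
      have hne := Finset.ne_of_mem_erase hj
      have : ¬ (j.val = i + 1) := fun h => hne (Fin.ext h)
      rw [ha', if_neg this]
    rw [he, h1, ha', if_pos rfl]
    omega
  refine ⟨⟨hn, ?_, ?_, ?_, ?_⟩, hs, by omega⟩
  · rw [hp, if_neg (by omega)]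
    exact ha.first
  · rw [hp, if_neg (by omega)]
    exact ha.last
  · intro j
    rw [ha']
    have := ha.two_le j
    split_ifs <;> omega
  · intro j hj hjn
    have hst := ha.step j hj hjn
    rw [hp, hp]
    by_cases e1 : j = i + 1
    · subst e1
      rw [if_pos rfl, if_neg (by omega), p1]
      omega
    · by_cases e2 : j = i + 2
      · subst e2
        rw [if_neg (by omega), if_pos rfl, p3]
        omega
      · rw [if_neg (by omega), if_neg e2]
        exact hst
end

section
/- Let a : Fin m → ℕ and b : Fin k → ℕ be admissible width sequences (with m, k ≥ 1). Define c : Fin (m + k − 1) → ℕ by c j = a j for j ≤ m − 1 and c (m − 1 + j) = b j for 1 ≤ j ≤ k − 1 (identifying the last value a(m−1) = 2 of a with the first value b 0 = 2 of b). Then c is an admissible width sequence and its width satisfies Σⱼ c j = (Σᵢ a i) + (Σᵢ b i) − 2. -/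
/-- The concatenation of two admissible width sequences
(identifying the last value of the first with the first value of the second) is
an admissible width sequence whose width is the sum of the widths minus `2`. -/
theorem width_of_concatenation
    (m k : ℕ) (hm : 1 ≤ m) (hk : 1 ≤ k)
    (a : Fin m → ℕ) (b : Fin k → ℕ)
    (ha : IsWidthSeq m a) (hb : IsWidthSeq k b)
    (c : Fin (m + k - 1) → ℕ)
    (hc1 : ∀ j : ℕ, (h : j < m) → c ⟨j, by omega⟩ = a ⟨j, h⟩)
    (hc2 : ∀ j : ℕ, 1 ≤ j → (h : j < k) → c ⟨m - 1 + j, by omega⟩ = b ⟨j, h⟩) :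
    IsWidthSeq (m + k - 1) c ∧
      (∑ j : Fin (m + k - 1), c j) + 2 = (∑ i : Fin m, a i) + ∑ i : Fin k, b i := by
  have P1 : ∀ j : ℕ, 1 ≤ j → j ≤ m → padded (m + k - 1) c j = padded m a j := by
    intro j h1 h2
    unfold padded
    rw [dif_pos ⟨h1, by omega⟩, dif_pos ⟨h1, h2⟩]
    exact hc1 (j - 1) (by omega)
  have P2 : ∀ j : ℕ, 1 ≤ j → j ≤ k → padded (m + k - 1) c (m - 1 + j) = padded k b j := by
    intro j h1 h2
    rcases Nat.eq_or_lt_of_le h1 with h | h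
    · subst h
      have e : m - 1 + 1 = m := by omega
      rw [e, P1 m hm le_rfl, ha.last, hb.first]
    · unfold padded
      rw [dif_pos ⟨by omega, by omega⟩, dif_pos ⟨h1, h2⟩, ← hc2 (j - 1) (by omega) (by omega)]
      congr 2
      omega
  refine ⟨⟨by omega, ?_, ?_, ?_, ?_⟩, ?_⟩
  · rw [P1 1 le_rfl hm, ha.first]
  · have e : m + k - 1 = m - 1 + k := by omega
    have := P2 k hk le_rfl
    rw [← e] at this
    rw [this, hb.last]
  · rintro ⟨i, hi⟩
    by_cases h : i < m
    · rw [hc1 i h]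
      exact ha.two_le _
    · have h2 := hc2 (i - (m - 1)) (by omega) (by omega)
      have e : m - 1 + (i - (m - 1)) = i := by omega
      simp only [e] at h2
      rw [h2]
      exact hb.two_le _
  · intro j h1 h2
    by_cases h : j < m
    · rw [P1 j h1 h.le, P1 (j + 1) (by omega) h]
      exact ha.step j h1 h
    · obtain ⟨t, rfl⟩ : ∃ t, j = m - 1 + t := ⟨j - (m - 1), by omega⟩
      rw [add_assoc, P2 t (by omega) (by omega), P2 (t + 1) (by omega) (by omega)]
      exact hb.step t (by omega) (by omega)
  · have hb0 := hb.first
    obtain ⟨k, rfl⟩ : ∃ t, k = t + 1 := ⟨k - 1, by omega⟩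
    have hb0' : b 0 = 2 := by
      unfold padded at hb0
      rw [dif_pos ⟨le_rfl, hk⟩] at hb0
      exact hb0
    have hs : (∑ j : Fin (m + (k + 1) - 1), c j) = (∑ i : Fin m, a i) + ∑ i : Fin k, b i.succ := by
      change (∑ j : Fin (m + k), c j) = _
      rw [Fin.sum_univ_add]
      congr 1
      · exact Finset.sum_congr rfl fun i _ => hc1 i.1 i.2
      · refine Finset.sum_congr rfl fun i _ => ?_
        have h2 := hc2 (i.1 + 1) (by omega) (by omega)
        have e : m - 1 + (i.1 + 1) = m + i.1 := by omega
        simp only [e] at h2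
        exact h2
    rw [hs, Fin.sum_univ_succ b, hb0']
    ring
end

section
/- Let a : Fin m → ℕ and b : Fin k → ℕ be admissible width sequences (with m, k ≥ 1), and let c : Fin (m + k − 1) → ℕ be their concatenation, defined by c j = a j for j ≤ m − 1 and c (m − 1 + j) = b j for 1 ≤ j ≤ k − 1. Then c is an admissible width sequence and the number of descents of its padded sequence (the number of maxima of the corresponding knot presentation) satisfies D(c) = D(a) + D(b) − 1, where D(a) denotes the number of indices i with a(i) > a(i+1) in the padded sequence of a. -/
/-- The number of descents of the padded sequence of `a`: the number of indices
`j` with `padded j > padded (j+1)`.  Each descent corresponds to a maximum of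
the corresponding knot presentation. -/
def descents (n : ℕ) (a : Fin n → ℕ) : ℕ :=
  ((Finset.range (n + 1)).filter (fun j => padded n a (j + 1) < padded n a j)).card

/-- The concatenation of two admissible width sequences is an
admissible width sequence, and its number of descents (maxima) is the sum of the
numbers of descents of the two sequences minus `1`. -/
theorem descents_of_concatenation
    (m k : ℕ) (hm : 1 ≤ m) (hk : 1 ≤ k)
    (a : Fin m → ℕ) (b : Fin k → ℕ)
    (ha : IsWidthSeq m a) (hb : IsWidthSeq k b)
    (c : Fin (m + k - 1) → ℕ)
    (hc1 : ∀ j : ℕ, (h : j < m) → c ⟨j, by omega⟩ = a ⟨j, h⟩)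
    (hc2 : ∀ j : ℕ, 1 ≤ j → (h : j < k) → c ⟨m - 1 + j, by omega⟩ = b ⟨j, h⟩) :
    IsWidthSeq (m + k - 1) c ∧
      descents (m + k - 1) c + 1 = descents m a + descents k b := by
  have hA : ∀ j, j ≤ m → padded (m + k - 1) c j = padded m a j := by
    intro j hj
    unfold padded
    by_cases h1 : 1 ≤ j
    · rw [dif_pos ⟨h1, by omega⟩, dif_pos ⟨h1, hj⟩]
      exact hc1 (j - 1) (by omega)
    · rw [dif_neg (by omega), dif_neg (by omega)]
  have hB : ∀ j, padded (m + k - 1) c (m + j) = padded k b (j + 1) := by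
    intro j
    rcases Nat.eq_zero_or_pos j with rfl | hj
    · rw [Nat.add_zero, hA m le_rfl, ha.last, Nat.zero_add, hb.first]
    · unfold padded
      by_cases h1 : j + 1 ≤ k
      · rw [dif_pos ⟨by omega, by omega⟩, dif_pos ⟨by omega, h1⟩]
        have h2 := hc2 j hj (by omega)
        have e : m + j - 1 = m - 1 + j := by omega
        simp only [e, Nat.add_sub_cancel]
        exact h2
      · rw [dif_neg (by omega), dif_neg (by omega)]
  have ha0 : padded m a (m + 1) = 0 := by
    unfold padded
    rw [dif_neg (by omega)]
  have hb0 : padded k b 0 = 0 := by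
    unfold padded
    rw [dif_neg (by omega)]
  refine ⟨⟨by omega, ?_, ?_, ?_, ?_⟩, ?_⟩
  · rw [hA 1 hm, ha.first]
  · have h := hB (k - 1)
    rw [show m + (k - 1) = m + k - 1 by omega, show k - 1 + 1 = k by omega, hb.last] at h
    exact h
  · rintro ⟨i, hi⟩
    by_cases h : i < m
    · rw [hc1 i h]
      exact ha.two_le _
    · have h2 := hc2 (i - (m - 1)) (by omega) (by omega)
      have e : m - 1 + (i - (m - 1)) = i := by omega
      simp only [e] at h2
      rw [h2]
      exact hb.two_le _
  · intro j h1 h2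
    by_cases h : j < m
    · rw [hA j h.le, hA (j + 1) h]
      exact ha.step j h1 h
    · obtain ⟨i, rfl⟩ := Nat.exists_eq_add_of_le (not_lt.mp h)
      rw [Nat.add_assoc, hB, hB]
      exact hb.step (i + 1) (by omega) (by omega)
  · unfold descents
    rw [show m + k - 1 + 1 = m + k by omega]
    simp only [Finset.card_filter]
    rw [Finset.sum_range_add, Finset.sum_range_succ _ m, Finset.sum_range_succ' _ k,
      ha0, ha.last, hb0]
    have e1 : ∀ j ∈ Finset.range m,
        (if padded (m + k - 1) c (j + 1) < padded (m + k - 1) c j then 1 else 0)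
          = if padded m a (j + 1) < padded m a j then 1 else 0 := by
      intro j hj
      have hj := Finset.mem_range.mp hj
      rw [hA j hj.le, hA (j + 1) hj]
    rw [Finset.sum_congr rfl e1]
    simp only [Nat.add_assoc m, hB]
    simp
    omega
end
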